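/- Let N, k, m be integers with k, m ≥ 0 and k + m ≤ N. Then in K: Σ_{J ⊆ {1,…,N}, |J| = k} x_J Σ_{J' ⊆ J^c, |J'| = m} Ã_{J∪J'} = t^{-m(N−k−m)} · [N−k choose m]_t · Σ_{J ⊆ {1,…,N}, |J| = k} x_J. -/

import Mathlib

open Finset MvPolynomial

set_option synthInstance.maxHeartbeats 1000000
set_option maxHeartbeats 1000000

noncomputable section

/-- The field ℚ(q,t): fraction field of ℚ[q,t] (variables indexed by `Bool`). -/
abbrev Fqt : Type := FractionRing (MvPolynomial Bool ℚ)

/-- The polynomial ring ℚ(q,t)[x₁,…,x_N]. -/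
abbrev Rx (N : ℕ) : Type := MvPolynomial (Fin N) Fqt

/-- The field K = ℚ(q,t,x₁,…,x_N), realized as the fraction field of ℚ(q,t)[x₁,…,x_N]. -/
abbrev K (N : ℕ) : Type := FractionRing (Rx N)

/-- The indeterminate q, as an element of K. -/
def qK (N : ℕ) : K N :=
  algebraMap (Rx N) (K N) (C (algebraMap (MvPolynomial Bool ℚ) Fqt (X true)))

/-- The indeterminate t, as an element of K. -/
def tK (N : ℕ) : K N :=
  algebraMap (Rx N) (K N) (C (algebraMap (MvPolynomial Bool ℚ) Fqt (X false)))

/-- The indeterminate x_i, as an element of K. -/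
def xK {N : ℕ} (i : Fin N) : K N := algebraMap (Rx N) (K N) (X i)

/-- The q-Pochhammer symbol (a;b)_n = ∏_{i=0}^{n-1} (1 - a·bⁱ). -/
def poch {F : Type*} [Field F] (a b : F) (n : ℕ) : F :=
  ∏ i ∈ Finset.range n, (1 - a * b ^ i)

/-- x_I = ∏_{i ∈ I} x_i. -/
def xProd {N : ℕ} (I : Finset (Fin N)) : K N := ∏ i ∈ I, xK i

/-- Ã_I^J = ∏_{i ∈ I, j ∈ J∖I} (x_i − t⁻¹x_j)/(x_i − x_j). -/
def Atilde {N : ℕ} (I J : Finset (Fin N)) : K N :=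
  ∏ i ∈ I, ∏ j ∈ J \ I, (xK i - (tK N)⁻¹ * xK j) / (xK i - xK j)


/-- The set {1,…,N} ∖ {1,…,ℓ}, i.e. the last N − ℓ of the N variable indices. -/
def highSet (N ℓ : ℕ) : Finset (Fin N) := Finset.univ.filter fun i => ℓ ≤ (i : ℕ)

/-- The set {1,…,ℓ}, i.e. the first ℓ of the N variable indices. -/
def lowSet (N ℓ : ℕ) : Finset (Fin N) := Finset.univ.filter fun i => (i : ℕ) < ℓ

/-- Shortcut instance to speed up typeclass search on K. -/
noncomputable instance instKField (N : ℕ) : Field (K N) := inferInstance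

/-- The t-binomial coefficient [n choose k]_t = (t;t)_n / ((t;t)_k (t;t)_{n−k}),
as an element of K. -/
def tbinomK (N : ℕ) (n k : ℕ) : K N :=
  poch (tK N) (tK N) n / (poch (tK N) (tK N) k * poch (tK N) (tK N) (n - k))

section GenericField

variable {ι F : Type*} [Field F]

/-- The elementary symmetric polynomial `e_k` in the variables indexed by `S`. -/
def elemSymm (x : ι → F) (k : ℕ) (S : Finset ι) : F :=
  ∑ J ∈ powersetCard k S, ∏ i ∈ J, x i

theorem elemSymm_zero (x : ι → F) (S : Finset ι) : elemSymm x 0 S = 1 := by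
  simp [elemSymm]

theorem elemSymm_eq_zero (x : ι → F) {k : ℕ} {S : Finset ι} (h : #S < k) :
    elemSymm x k S = 0 := by
  simp [elemSymm, powersetCard_eq_empty.2 h]

theorem elemSymm_card (x : ι → F) (S : Finset ι) : elemSymm x #S S = ∏ i ∈ S, x i := by
  simp [elemSymm]

variable [DecidableEq ι]

/-- `∏_{i ∈ I, j ∈ S ∖ I} (x_i - u x_j) / (x_i - x_j)`. -/
def crossProd (u : F) (x : ι → F) (I S : Finset ι) : F :=
  ∏ i ∈ I, ∏ j ∈ S \ I, (x i - u * x j) / (x i - x j)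

/-- The sum of `e_k(x_I)` over `I ⊆ S` with `|I| = n`, weighted by `crossProd`. -/
def weightedSum (u : F) (x : ι → F) (k n : ℕ) (S : Finset ι) : F :=
  ∑ I ∈ powersetCard n S, crossProd u x I S * elemSymm x k I

theorem elemSymm_succ (x : ι → F) (k : ℕ) {S : Finset ι} {i : ι} (hi : i ∈ S) :
    elemSymm x (k + 1) S =
      elemSymm x (k + 1) (S.erase i) + x i * elemSymm x k (S.erase i) := by
  have hn : i ∉ S.erase i := notMem_erase i S
  conv_lhs => rw [← insert_erase hi]
  unfold elemSymm
  rw [powersetCard_succ_insert hn, sum_union, sum_image, mul_sum]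
  · congr 1
    refine sum_congr rfl fun J hJ => prod_insert fun h => hn ((mem_powersetCard.1 hJ).1 h)
  · intro J hJ J' hJ' h
    have h1 : i ∉ J := fun h => hn ((mem_powersetCard.1 hJ).1 h)
    have h2 : i ∉ J' := fun h => hn ((mem_powersetCard.1 hJ').1 h)
    rw [← erase_insert h1, ← erase_insert h2, h]
  · rw [disjoint_left]
    intro J hJ hJ'
    obtain ⟨J', -, rfl⟩ := mem_image.1 hJ'
    exact hn ((mem_powersetCard.1 hJ).1 (mem_insert_self i J'))

theorem crossProd_singleton (u : F) (x : ι → F) (i : ι) (S : Finset ι) :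
    crossProd u x {i} S = ∏ j ∈ S.erase i, (x i - u * x j) / (x i - x j) := by
  simp [crossProd, sdiff_singleton_eq_erase]

/-- Lagrange interpolation of `∏ (X + x_j) - ∏ (X + u x_j)` at the nodes `-x_i`. -/
theorem sum_crossProd_mul_prod_X_add (u : F) {x : ι → F} (hx : Function.Injective x)
    (S : Finset ι) :
    ∑ i ∈ S, Polynomial.C ((1 - u) * x i * crossProd u x {i} S) *
        ∏ j ∈ S.erase i, (Polynomial.X + Polynomial.C (x j)) =
      ∏ j ∈ S, (Polynomial.X + Polynomial.C (x j)) -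
        ∏ j ∈ S, (Polynomial.X + Polynomial.C (u * x j)) := by
  have hdeg : ∀ (y : ι → F) (T : Finset ι),
      (∏ j ∈ T, (Polynomial.X + Polynomial.C (y j))).degree = (#T : WithBot ℕ) :=
    fun y T => by simp [Polynomial.degree_prod]
  have hmon : ∀ (y : ι → F), (∏ j ∈ S, (Polynomial.X + Polynomial.C (y j))).Monic := fun y =>
    Polynomial.monic_prod_of_monic _ _ fun j _ => Polynomial.monic_X_add_C (y j)
  refine Polynomial.eq_of_degrees_lt_of_eval_index_eq (v := fun i => -x i) S
    (fun i _ j _ h => hx (neg_injective h)) ?_ ?_ ?_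
  · rw [← Polynomial.mem_degreeLT]
    refine Submodule.sum_mem _ fun i hi => ?_
    rw [Polynomial.C_mul']
    refine Submodule.smul_mem _ _ (Polynomial.mem_degreeLT.2 ?_)
    rw [hdeg]
    exact_mod_cast card_erase_lt_of_mem hi
  · rw [← hdeg x S]
    refine Polynomial.degree_sub_lt_left ?_ (hmon _).ne_zero ?_
    · rw [hdeg, hdeg]
    · rw [(hmon _).leadingCoeff, (hmon _).leadingCoeff]
  · intro i hi
    rw [Polynomial.eval_finsetSum, Polynomial.eval_sub, Polynomial.eval_prod,
      Polynomial.eval_prod, sum_eq_single_of_mem i hi, prod_eq_zero hi (by simp)]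
    · simp only [Polynomial.eval_mul, Polynomial.eval_C, Polynomial.eval_prod,
        Polynomial.eval_add, Polynomial.eval_X]
      rw [crossProd_singleton, mul_assoc, ← prod_mul_distrib, ← mul_prod_erase S _ hi]
      have : ∀ j ∈ S.erase i, (x i - u * x j) / (x i - x j) * (-x i + x j) =
          -x i + u * x j := fun j hj => by
        have : x i - x j ≠ 0 := sub_ne_zero.2 fun h => (ne_of_mem_erase hj) (hx h).symm
        field_simp
        ring
      rw [prod_congr rfl this]
      ring
    · intro j hj hij
      rw [Polynomial.eval_mul, Polynomial.eval_prod,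
        prod_eq_zero (mem_erase.2 ⟨hij.symm, hi⟩) (by simp), mul_zero]

theorem sum_crossProd_mul_elemSymm (u : F) {x : ι → F} (hx : Function.Injective x)
    (S : Finset ι) (k : ℕ) :
    (1 - u) * ∑ i ∈ S, crossProd u x {i} S * (x i * elemSymm x k (S.erase i)) =
      (1 - u ^ (k + 1)) * elemSymm x (k + 1) S := by
  rcases lt_or_ge #S (k + 1) with h | h
  · rw [elemSymm_eq_zero x h, mul_zero, sum_eq_zero, mul_zero]
    intro i hi
    rw [elemSymm_eq_zero, mul_zero, mul_zero]
    have := card_erase_lt_of_mem hi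
    omega
  · have key := congrArg (fun p => Polynomial.coeff p (#S - (k + 1)))
      (sum_crossProd_mul_prod_X_add u hx S)
    simp only [Polynomial.finsetSum_coeff, Polynomial.coeff_C_mul, Polynomial.coeff_sub] at key
    rw [Finset.prod_X_add_C_coeff _ _ (Nat.sub_le _ _),
      Finset.prod_X_add_C_coeff _ _ (Nat.sub_le _ _), Nat.sub_sub_self h] at key
    have hu : ∑ J ∈ powersetCard (k + 1) S, ∏ j ∈ J, u * x j =
        u ^ (k + 1) * elemSymm x (k + 1) S := by
      rw [elemSymm, mul_sum]
      refine sum_congr rfl fun J hJ => ?_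
      rw [prod_mul_distrib, prod_const, (mem_powersetCard.1 hJ).2]
    rw [hu] at key
    refine Eq.trans ?_ (key.trans (by rw [sub_mul, one_mul]; rfl))
    rw [mul_sum]
    refine sum_congr rfl fun i hi => ?_
    have hc := card_erase_of_mem hi
    rw [Finset.prod_X_add_C_coeff _ _ (by omega), elemSymm,
      show #(S.erase i) - (#S - (k + 1)) = k by omega]
    ring

theorem sum_crossProd_singleton {u : F} {x : ι → F} (hx : Function.Injective x)
    (hx0 : ∀ i, x i ≠ 0) (S : Finset ι) :
    (1 - u) * ∑ i ∈ S, crossProd u x {i} S = 1 - u ^ #S := by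
  rcases S.eq_empty_or_nonempty with rfl | hS
  · simp
  obtain ⟨n, hn⟩ : ∃ n, #S = n + 1 := ⟨#S - 1, by have := hS.card_pos; omega⟩
  have key := sum_crossProd_mul_elemSymm u hx S n
  rw [← hn, elemSymm_card] at key
  refine mul_right_cancel₀ (prod_ne_zero_iff.2 fun i (_ : i ∈ S) => hx0 i) ?_
  rw [← key, mul_assoc, sum_mul]
  congr 1
  refine sum_congr rfl fun i hi => ?_
  have : n = #(S.erase i) := by rw [card_erase_of_mem hi]; omega
  rw [this, elemSymm_card, mul_prod_erase S x hi]

theorem sum_crossProd_mul_elemSymm_erase {u : F} {x : ι → F} (hx : Function.Injective x)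
    (hx0 : ∀ i, x i ≠ 0) (S : Finset ι) (k : ℕ) :
    (1 - u) * ∑ i ∈ S, crossProd u x {i} S * elemSymm x k (S.erase i) =
      (u ^ k - u ^ #S) * elemSymm x k S := by
  cases k with
  | zero =>
    simp only [elemSymm_zero, mul_one, pow_zero]
    exact sum_crossProd_singleton hx hx0 S
  | succ k =>
    have h : ∀ i ∈ S, crossProd u x {i} S * elemSymm x (k + 1) (S.erase i) =
        crossProd u x {i} S * elemSymm x (k + 1) S -
          crossProd u x {i} S * (x i * elemSymm x k (S.erase i)) := fun i hi => by
      rw [elemSymm_succ x k hi]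
      ring
    rw [sum_congr rfl h, sum_sub_distrib, ← sum_mul, mul_sub, ← mul_assoc,
      sum_crossProd_singleton hx hx0, sum_crossProd_mul_elemSymm u hx]
    ring

theorem crossProd_singleton_mul (u : F) (x : ι → F) {I S : Finset ι} (hI : I ⊆ S) {i : ι}
    (hi : i ∈ I) :
    crossProd u x {i} I * crossProd u x I S =
      crossProd u x {i} S * crossProd u x (I.erase i) (S.erase i) := by
  have hS : S.erase i = I.erase i ∪ S \ I := by
    ext j
    by_cases hj : j = i
    · subst hj; simp [hi]
    · have := @hI j
      simp only [mem_erase, mem_union, mem_sdiff]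
      tauto
  have hd : Disjoint (I.erase i) (S \ I) :=
    disjoint_sdiff.mono_left (erase_subset i I)
  have hS' : S.erase i \ I.erase i = S \ I := by
    rw [hS, union_sdiff_cancel_left hd]
  rw [crossProd_singleton, crossProd_singleton, hS, prod_union hd, ← hS]
  unfold crossProd
  rw [hS', ← mul_prod_erase I _ hi]
  ring

theorem sum_powersetCard_succ_sum {M : Type*} [AddCommMonoid M] (n : ℕ) (S : Finset ι)
    (g : ι → Finset ι → M) :
    ∑ I ∈ powersetCard (n + 1) S, ∑ i ∈ I, g i (I.erase i) =
      ∑ i ∈ S, ∑ I ∈ powersetCard n (S.erase i), g i I := by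
  rw [sum_sigma', sum_sigma']
  refine sum_bij' (fun p _ => ⟨p.2, p.1.erase p.2⟩) (fun p _ => ⟨insert p.1 p.2, p.1⟩)
    ?_ ?_ ?_ ?_ ?_
  · rintro ⟨I, i⟩ h
    simp only [mem_sigma, mem_powersetCard] at h ⊢
    refine ⟨h.1.1 h.2, erase_subset_erase i h.1.1, ?_⟩
    rw [card_erase_of_mem h.2, h.1.2, Nat.add_sub_cancel]
  · rintro ⟨i, I⟩ h
    simp only [mem_sigma, mem_powersetCard] at h ⊢
    have hi : i ∉ I := fun hi => notMem_erase i S (h.2.1 hi)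
    refine ⟨⟨insert_subset h.1 (h.2.1.trans (erase_subset i S)), ?_⟩, mem_insert_self i I⟩
    rw [card_insert_of_notMem hi, h.2.2]
  · rintro ⟨I, i⟩ h
    simp only [mem_sigma] at h
    simp [insert_erase h.2]
  · rintro ⟨i, I⟩ h
    simp only [mem_sigma, mem_powersetCard] at h
    have hi : i ∉ I := fun hi => notMem_erase i S (h.2.1 hi)
    simp [erase_insert hi]
  · rintro ⟨I, i⟩ _
    rfl

theorem weightedSum_recursion {u : F} {x : ι → F} (hx : Function.Injective x)
    (hx0 : ∀ i, x i ≠ 0) (k n : ℕ) (S : Finset ι) :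
    (1 - u ^ (n + 1)) * weightedSum u x k (n + 1) S =
      (1 - u) * ∑ i ∈ S, ∑ I ∈ powersetCard n (S.erase i),
        crossProd u x {i} S * (crossProd u x I (S.erase i) * elemSymm x k (insert i I)) := by
  rw [← sum_powersetCard_succ_sum n S fun i I =>
    crossProd u x {i} S * (crossProd u x I (S.erase i) * elemSymm x k (insert i I)),
    weightedSum, mul_sum, mul_sum]
  refine sum_congr rfl fun I hI => ?_
  obtain ⟨hIS, hI⟩ := mem_powersetCard.1 hI
  rw [← hI, ← sum_crossProd_singleton hx hx0 I, mul_assoc, sum_mul]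
  congr 1
  refine sum_congr rfl fun i hi => ?_
  rw [insert_erase hi, ← mul_assoc, ← mul_assoc, crossProd_singleton_mul u x hIS hi]

theorem weightedSum_zero_recursion {u : F} {x : ι → F} (hx : Function.Injective x)
    (hx0 : ∀ i, x i ≠ 0) (n : ℕ) (S : Finset ι) :
    (1 - u ^ (n + 1)) * weightedSum u x 0 (n + 1) S =
      (1 - u) * ∑ i ∈ S, crossProd u x {i} S * weightedSum u x 0 n (S.erase i) := by
  rw [weightedSum_recursion hx hx0]
  simp only [elemSymm_zero, weightedSum, mul_sum]

theorem weightedSum_succ_recursion {u : F} {x : ι → F} (hx : Function.Injective x)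
    (hx0 : ∀ i, x i ≠ 0) (k n : ℕ) (S : Finset ι) :
    (1 - u ^ (n + 1)) * weightedSum u x (k + 1) (n + 1) S =
      (1 - u) * ∑ i ∈ S, crossProd u x {i} S * weightedSum u x (k + 1) n (S.erase i) +
      (1 - u) * ∑ i ∈ S, crossProd u x {i} S * (x i * weightedSum u x k n (S.erase i)) := by
  rw [weightedSum_recursion hx hx0, ← mul_add, ← sum_add_distrib]
  congr 1
  refine sum_congr rfl fun i _ => ?_
  rw [weightedSum, weightedSum, mul_sum, mul_sum, mul_sum, ← sum_add_distrib]
  refine sum_congr rfl fun I hI => ?_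
  have hi : i ∉ I := fun hi => notMem_erase i S ((mem_powersetCard.1 hI).1 hi)
  rw [elemSymm_succ x k (mem_insert_self i I), erase_insert hi]
  ring

theorem weightedSum_eq_zero (u : F) (x : ι → F) {k n : ℕ} (h : n < k) (S : Finset ι) :
    weightedSum u x k n S = 0 := by
  refine sum_eq_zero fun I hI => ?_
  rw [elemSymm_eq_zero x (by rw [(mem_powersetCard.1 hI).2]; exact h), mul_zero]

theorem poch_succ (a b : F) (n : ℕ) : poch a b (n + 1) = poch a b n * (1 - a * b ^ n) :=
  prod_range_succ _ _

theorem poch_mul_weightedSum {u : F} {x : ι → F} (hx : Function.Injective x)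
    (hx0 : ∀ i, x i ≠ 0) (hu : ∀ n : ℕ, 1 - u ^ (n + 1) ≠ 0) (n k m p : ℕ) (S : Finset ι)
    (hn : n = k + m) (hS : #S = n + p) :
    poch u u m * poch u u p * weightedSum u x k n S = poch u u (m + p) * elemSymm x k S := by
  induction n generalizing k m S with
  | zero =>
    obtain ⟨rfl, rfl⟩ : k = 0 ∧ m = 0 := by omega
    simp [weightedSum, elemSymm_zero, crossProd, poch]
  | succ n ih =>
    have hcard : ∀ i ∈ S, #(S.erase i) = n + p := fun i hi => by
      rw [card_erase_of_mem hi]; omega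
    have hfirst : poch u u m * poch u u p *
        ((1 - u) * ∑ i ∈ S, crossProd u x {i} S * weightedSum u x k n (S.erase i)) =
        (u ^ k - u ^ (n + 1)) * poch u u (m + p) * elemSymm x k S := by
      cases m with
      | zero =>
        obtain rfl : k = n + 1 := by omega
        simp [weightedSum_eq_zero u x (Nat.lt_succ_self n)]
      | succ m =>
        have h : ∀ i ∈ S, poch u u m * poch u u p *
            (crossProd u x {i} S * weightedSum u x k n (S.erase i)) =
            poch u u (m + p) * (crossProd u x {i} S * elemSymm x k (S.erase i)) :=
          fun i hi => by
            rw [mul_left_comm, ih k m (S.erase i) (by omega) (hcard i hi)]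
            ring
        have key := sum_congr rfl h
        rw [← mul_sum, ← mul_sum] at key
        have key' := sum_crossProd_mul_elemSymm_erase (u := u) hx hx0 S k
        rw [hS, show n + 1 + p = k + (m + p + 1) by omega] at key'
        rw [show m + 1 + p = m + p + 1 by omega, poch_succ, poch_succ,
          show n + 1 = k + (m + 1) by omega]
        linear_combination (1 - u * u ^ m) * (1 - u) * key +
          (1 - u * u ^ m) * poch u u (m + p) * key'
    refine mul_left_cancel₀ (hu n) ?_
    cases k with
    | zero =>
      have hrec := weightedSum_zero_recursion (u := u) hx hx0 n S
      linear_combination poch u u m * poch u u p * hrec + hfirst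
    | succ k =>
      have hrec := weightedSum_succ_recursion (u := u) hx hx0 k n S
      have h : ∀ i ∈ S, poch u u m * poch u u p *
          (crossProd u x {i} S * (x i * weightedSum u x k n (S.erase i))) =
          poch u u (m + p) * (crossProd u x {i} S * (x i * elemSymm x k (S.erase i))) :=
        fun i hi => by
          rw [mul_left_comm, mul_left_comm _ (x i),
            ih k m (S.erase i) (by omega) (hcard i hi)]
          ring
      have key := sum_congr rfl h
      rw [← mul_sum, ← mul_sum] at key
      have key' := sum_crossProd_mul_elemSymm u hx S k
      linear_combination poch u u m * poch u u p * hrec + hfirst + (1 - u) * key +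
        poch u u (m + p) * key'

theorem inv_pow_mul_poch (t : F) (ht : t ≠ 0) (m p : ℕ) :
    t⁻¹ ^ (m * p) * poch t t (m + p) * (poch t⁻¹ t⁻¹ m * poch t⁻¹ t⁻¹ p) =
      poch t⁻¹ t⁻¹ (m + p) * (poch t t m * poch t t p) := by
  induction p with
  | zero => simp [poch]; ring
  | succ p ih =>
    have h : t⁻¹ ^ m * (1 - t * t ^ (m + p)) * (1 - t⁻¹ * t⁻¹ ^ p) =
        (1 - t⁻¹ * t⁻¹ ^ (m + p)) * (1 - t * t ^ p) := by
      simp only [inv_pow, pow_add]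
      field_simp
      ring
    rw [← add_assoc, poch_succ, poch_succ, poch_succ, poch_succ, Nat.mul_succ, pow_add]
    linear_combination
      t⁻¹ ^ m * (1 - t * t ^ (m + p)) * (1 - t⁻¹ * t⁻¹ ^ p) * ih +
        poch t⁻¹ t⁻¹ (m + p) * (poch t t m * poch t t p) * h

theorem poch_ne_zero {t : F} (ht : ∀ n : ℕ, 1 - t ^ (n + 1) ≠ 0) (n : ℕ) : poch t t n ≠ 0 :=
  prod_ne_zero_iff.2 fun i _ => by rw [← pow_succ']; exact ht i

theorem sum_prod_mul_sum_crossProd [Fintype ι] (u : F) (x : ι → F) (k m : ℕ) :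
    ∑ J ∈ powersetCard k (univ : Finset ι),
      (∏ i ∈ J, x i) * ∑ J' ∈ powersetCard m Jᶜ, crossProd u x (J ∪ J') univ =
    weightedSum u x k (k + m) univ := by
  simp only [weightedSum, elemSymm, mul_sum]
  rw [sum_sigma', sum_sigma']
  refine sum_bij' (fun p _ => ⟨p.1 ∪ p.2, p.1⟩) (fun p _ => ⟨p.2, p.1 \ p.2⟩) ?_ ?_ ?_ ?_ ?_
  · rintro ⟨J, J'⟩ h
    simp only [mem_sigma, mem_powersetCard] at h ⊢
    have hd : Disjoint J J' := (subset_compl_iff_disjoint_left).1 h.2.1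
    exact ⟨⟨subset_univ _, by rw [card_union_of_disjoint hd, h.1.2, h.2.2]⟩,
      subset_union_left, h.1.2⟩
  · rintro ⟨I, J⟩ h
    simp only [mem_sigma, mem_powersetCard] at h ⊢
    refine ⟨⟨subset_univ _, h.2.2⟩, fun i hi => ?_, ?_⟩
    · exact mem_compl.2 (mem_sdiff.1 hi).2
    · rw [card_sdiff_of_subset h.2.1, h.1.2, h.2.2, Nat.add_sub_cancel_left]
  · rintro ⟨J, J'⟩ h
    simp only [mem_sigma, mem_powersetCard] at h
    have hd : Disjoint J J' := (subset_compl_iff_disjoint_left).1 h.2.1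
    simp [union_sdiff_cancel_left hd]
  · rintro ⟨I, J⟩ h
    simp only [mem_sigma, mem_powersetCard] at h
    simp [union_sdiff_of_subset h.2.1]
  · rintro ⟨J, J'⟩ _
    exact mul_comm _ _

end GenericField

theorem xK_injective (N : ℕ) : Function.Injective (xK : Fin N → K N) := fun _ _ h =>
  X_injective (IsFractionRing.injective (Rx N) (K N) h)

theorem xK_ne_zero {N : ℕ} (i : Fin N) : xK i ≠ 0 := fun h =>
  X_ne_zero i (IsFractionRing.injective (Rx N) (K N) (h.trans (map_zero _).symm))

/-- The inclusion of `ℚ[q,t]` in `K`. -/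
def coeffHom (N : ℕ) : MvPolynomial Bool ℚ →+* K N :=
  (algebraMap (Rx N) (K N)).comp (C.comp (algebraMap (MvPolynomial Bool ℚ) Fqt))

theorem coeffHom_injective (N : ℕ) : Function.Injective (coeffHom N) :=
  (IsFractionRing.injective (Rx N) (K N)).comp
    ((C_injective (Fin N) Fqt).comp (IsFractionRing.injective (MvPolynomial Bool ℚ) Fqt))

theorem coeffHom_X_false (N : ℕ) : coeffHom N (X false) = tK N := rfl

theorem tK_ne_zero (N : ℕ) : tK N ≠ 0 := by
  rw [← coeffHom_X_false, map_ne_zero_iff _ (coeffHom_injective N)]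
  exact X_ne_zero _

theorem one_sub_tK_pow_ne_zero (N n : ℕ) : 1 - tK N ^ (n + 1) ≠ 0 := by
  rw [← coeffHom_X_false, ← map_pow, ← map_one (coeffHom N), ← map_sub,
    map_ne_zero_iff _ (coeffHom_injective N)]
  intro h
  simpa using congrArg (eval (0 : Bool → ℚ)) h

theorem one_sub_inv_tK_pow_ne_zero (N n : ℕ) : 1 - (tK N)⁻¹ ^ (n + 1) ≠ 0 := by
  rw [inv_pow, sub_ne_zero, ne_comm, Ne, inv_eq_one, eq_comm, ← sub_eq_zero]
  exact one_sub_tK_pow_ne_zero N n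

/-!
Statement 5 (Garsia–Tesler summation): for k + m ≤ N,
  ∑_{|J|=k} x_J ∑_{J'⊆Jᶜ, |J'|=m} Ã_{J∪J'}
    = t^{-m(N−k−m)} [N−k choose m]_t ∑_{|J|=k} x_J.
-/

theorem stmt5 (N k m : ℕ) (h : k + m ≤ N) :
    ∑ J ∈ powersetCard k (univ : Finset (Fin N)),
      xProd J * ∑ J' ∈ powersetCard m Jᶜ, Atilde (J ∪ J') univ
    = (tK N)⁻¹ ^ (m * (N - k - m)) * tbinomK N (N - k) m *
        ∑ J ∈ powersetCard k (univ : Finset (Fin N)), xProd J := by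
  obtain ⟨p, hp⟩ : ∃ p, N = k + m + p := ⟨N - (k + m), by omega⟩
  have ht := one_sub_tK_pow_ne_zero N
  have hu := one_sub_inv_tK_pow_ne_zero N
  have hsum := sum_prod_mul_sum_crossProd (tK N)⁻¹ (xK : Fin N → K N) k m
  have hmain := poch_mul_weightedSum (xK_injective N) xK_ne_zero hu (k + m) k m p univ rfl
    (by rw [card_univ, Fintype.card_fin]; exact hp)
  have hbinom := inv_pow_mul_poch (tK N) (tK_ne_zero N) m p
  have hu' : poch (tK N)⁻¹ (tK N)⁻¹ m * poch (tK N)⁻¹ (tK N)⁻¹ p ≠ 0 :=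
    mul_ne_zero (poch_ne_zero hu m) (poch_ne_zero hu p)
  have ht' : poch (tK N) (tK N) m * poch (tK N) (tK N) p ≠ 0 :=
    mul_ne_zero (poch_ne_zero ht m) (poch_ne_zero ht p)
  have h1 : N - k - m = p := by omega
  have h2 : N - k = m + p := by omega
  rw [tbinomK, h1, h2]
  refine hsum.trans (mul_left_cancel₀ hu' (hmain.trans ?_))
  change _ = _ * (_ * elemSymm xK k univ)
  rw [← mul_assoc]
  congr 1
  rw [← mul_div_assoc, mul_div_assoc', eq_div_iff ht']
  linear_combination -hbinom

end
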